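/- Let G = (V, E) be a finite directed graph with adjacency matrix M over ℚ, and let v, v' ∈ V. If there exists i ≥ 1 such that the column sums Σ_u (M^i)[u,v] ≠ Σ_u (M^i)[u,v'], then the smallest such i is at most 2|V| - 1. -/

import Mathlib

theorem stmt4 {V : Type*} [Fintype V] [DecidableEq V]
    (E : V → V → Prop) [DecidableRel E]
    (M : Matrix V V ℚ) (hM : ∀ u w, M u w = if E u w then 1 else 0)
    (v v' : V)
    (h : ∃ i : ℕ, 1 ≤ i ∧ ∑ u : V, (M ^ i) u v ≠ ∑ u : V, (M ^ i) u v') :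
    ∃ i : ℕ, 1 ≤ i ∧ i ≤ 2 * Fintype.card V - 1 ∧
      ∑ u : V, (M ^ i) u v ≠ ∑ u : V, (M ^ i) u v' := by
  by_contra hcon
  push Not at hcon
  obtain ⟨i, _, hi⟩ := h
  let f : Matrix V V ℚ →ₗ[ℚ] ℚ :=
    { toFun := fun A => ∑ u : V, A u v - ∑ u : V, A u v'
      map_add' := fun A B => by
        simp only [Matrix.add_apply, Finset.sum_add_distrib]; ring
      map_smul' := fun c A => by
        simp only [Matrix.smul_apply, smul_eq_mul, ← Finset.mul_sum, RingHom.id_apply]; ring }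
  have hf : ∀ A : Matrix V V ℚ, f A = ∑ u : V, A u v - ∑ u : V, A u v' := fun _ => rfl
  have hcard : 0 < Fintype.card V := Fintype.card_pos_iff.mpr ⟨v⟩
  have hsmall : ∀ j < Fintype.card V, f (M ^ j) = 0 := by
    intro j hj
    rcases Nat.eq_zero_or_pos j with rfl | hpos
    · simp [hf, Matrix.one_apply]
    · rw [hf, hcon j hpos (by omega), sub_self]
  have hdeg : (Polynomial.X ^ i %ₘ M.charpoly).natDegree < Fintype.card V := by
    rw [← M.charpoly_natDegree_eq_dim]
    apply Polynomial.natDegree_modByMonic_lt _ M.charpoly_monic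
    intro h1
    have h2 := M.charpoly_natDegree_eq_dim
    rw [h1, Polynomial.natDegree_one] at h2
    omega
  have hall : f (M ^ i) = 0 := by
    rw [M.pow_eq_aeval_mod_charpoly i, Polynomial.aeval_eq_sum_range' hdeg, map_sum]
    apply Finset.sum_eq_zero
    intro j hj
    rw [map_smul, hsmall j (Finset.mem_range.mp hj), smul_zero]
  exact hi (sub_eq_zero.mp hall)
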